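/- Let n be odd, n ≥ 3, and let 1 ≤ s_1 < s_2 < … < s_k < n/2 be integers with gcd(s_1,…,s_k,n) = 1, and let τ(n) be the number of spanning trees of the circulant graph C_n(s_1,…,s_k). Then there exists a nonnegative integer a such that τ(n) = n · a². -/

import Mathlib

open Polynomial Complex Finset
open scoped Classical

/-- The circulant graph `C_n(s 0, …, s (k-1))` on vertex set `ZMod n`:
`i` is adjacent to `i ± s j (mod n)` for each `j`. -/
def circulant (n : ℕ) {k : ℕ} (s : Fin k → ℕ) : SimpleGraph (ZMod n) :=
  SimpleGraph.circulantGraph {x : ZMod n | ∃ j : Fin k, x = (s j : ZMod n)}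

/-- The odd-valency circulant graph `C_{2n}(s 0, …, s (k-1), n)` on vertex set `ZMod (2n)`:
`i` is adjacent to `i ± s j (mod 2n)` for each `j`, and to `i + n (mod 2n)`. -/
def circulantOdd (n : ℕ) {k : ℕ} (s : Fin k → ℕ) : SimpleGraph (ZMod (2 * n)) :=
  SimpleGraph.circulantGraph
    ({x : ZMod (2 * n) | ∃ j : Fin k, x = (s j : ZMod (2 * n))} ∪ {(n : ZMod (2 * n))})

/-- The number of spanning trees of `G`: the number of subgraphs of `G` (on the same
vertex set) that are trees. -/
noncomputable def numSpanningTrees {V : Type*} (G : SimpleGraph V) : ℕ :=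
  Set.ncard {H : SimpleGraph V | H ≤ G ∧ H.IsTree}

section MatrixTree

variable {V : Type*} {r : V}

/-- Extend a map defined away from `r` to a self-map fixing `r`. -/
noncomputable def fixRoot (r : V) (f : {v // v ≠ r} → V) (v : V) : V :=
  if h : v ≠ r then f ⟨v, h⟩ else r

/-- Iterating `f` from any vertex eventually reaches the root `r`. -/
def ReachesRoot (f : {v // v ≠ r} → V) : Prop :=
  ∀ v, ∃ k : ℕ, (fixRoot r f)^[k] v = r

/-- The graph joining every `v ≠ r` to its parent `f v`. -/
def parentGraph (f : {v // v ≠ r} → V) : SimpleGraph V :=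
  SimpleGraph.fromRel fun u v => ∃ h : u ≠ r, f ⟨u, h⟩ = v

theorem fixRoot_root (f : {v // v ≠ r} → V) : fixRoot r f r = r := by
  simp [fixRoot]

theorem fixRoot_coe (f : {v // v ≠ r} → V) (v : {v // v ≠ r}) : fixRoot r f v = f v := by
  simp [fixRoot, v.2]

theorem fixRoot_iterate_root (f : {v // v ≠ r} → V) (k : ℕ) : (fixRoot r f)^[k] r = r :=
  Function.iterate_fixed (fixRoot_root f) k

/-- A property preserved by the parent map off the root, and false at the root, never holds. -/
theorem ReachesRoot.not_of_invariant {f : {v // v ≠ r} → V} (hf : ReachesRoot f) {P : V → Prop}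
    (hP : ∀ v, P v → P (fixRoot r f v)) (hr : ¬ P r) (v : V) : ¬ P v := by
  intro hv
  obtain ⟨k, hk⟩ := hf v
  have : ∀ k, P ((fixRoot r f)^[k] v) := by
    intro k
    induction k with
    | zero => exact hv
    | succ k ih => rw [Function.iterate_succ_apply']; exact hP _ ih
  exact hr (hk ▸ this k)

theorem ReachesRoot.ne_self {f : {v // v ≠ r} → V} (hf : ReachesRoot f) (v : {v // v ≠ r}) :
    f v ≠ v := by
  intro h
  refine hf.not_of_invariant (P := fun u => u = v) ?_ (fun h => v.2 h.symm) v rfl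
  rintro _ rfl
  rw [fixRoot_coe, h]

theorem ReachesRoot.parent_parent_ne {f : {v // v ≠ r} → V} (hf : ReachesRoot f)
    (v : {v // v ≠ r}) (hv : f v ≠ r) : f ⟨f v, hv⟩ ≠ v := by
  intro h
  refine hf.not_of_invariant (P := fun u => u = v ∨ u = f v) ?_ ?_ v (Or.inl rfl)
  · rintro _ (rfl | rfl)
    · exact Or.inr (fixRoot_coe f v)
    · exact Or.inl ((fixRoot_coe f ⟨f v, hv⟩).trans h)
  · rintro (h | h)
    · exact v.2 h.symm
    · exact hv h.symm

theorem ReachesRoot.parentGraph_adj {f : {v // v ≠ r} → V} (hf : ReachesRoot f)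
    (v : {v // v ≠ r}) : (parentGraph f).Adj v (f v) := by
  rw [parentGraph, SimpleGraph.fromRel_adj]
  exact ⟨(hf.ne_self v).symm, Or.inl ⟨v.2, rfl⟩⟩

theorem ReachesRoot.connected_parentGraph {f : {v // v ≠ r} → V} (hf : ReachesRoot f) :
    (parentGraph f).Connected := by
  rw [SimpleGraph.connected_iff_exists_forall_reachable]
  refine ⟨r, fun v => ?_⟩
  by_contra hv
  refine hf.not_of_invariant (P := fun u => ¬ (parentGraph f).Reachable r u) ?_
    (not_not.2 (SimpleGraph.Reachable.refl r)) v hv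
  intro u hu hfu
  apply hu
  by_cases h : u = r
  · rw [h]
  · rw [fixRoot_coe f ⟨u, h⟩] at hfu
    exact hfu.trans (hf.parentGraph_adj ⟨u, h⟩).reachable.symm

theorem ReachesRoot.isTree_parentGraph [Finite V] {f : {v // v ≠ r} → V} (hf : ReachesRoot f) :
    (parentGraph f).IsTree := by
  classical
  have := Fintype.ofFinite V
  refine SimpleGraph.isTree_iff_connected_and_card.2 ⟨hf.connected_parentGraph, ?_⟩
  apply le_antisymm _ hf.connected_parentGraph.card_vert_le_card_edgeSet_add_one
  have hsub : (parentGraph f).edgeSet ⊆ Set.range fun v : {v // v ≠ r} => s(v.1, f v) := by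
    intro e
    induction e with | _ a b => ?_
    rw [SimpleGraph.mem_edgeSet, parentGraph, SimpleGraph.fromRel_adj]
    rintro ⟨-, ⟨h, rfl⟩ | ⟨h, rfl⟩⟩
    · exact ⟨⟨a, h⟩, rfl⟩
    · exact ⟨⟨b, h⟩, Sym2.eq_swap⟩
  have h1 : Nat.card (parentGraph f).edgeSet ≤ Nat.card {v // v ≠ r} :=
    (Nat.card_mono (Set.toFinite _) hsub).trans (Finite.card_range_le _)
  have h2 : Nat.card {v // v ≠ r} + 1 = Nat.card V := by
    rw [Nat.card_eq_fintype_card, Nat.card_eq_fintype_card, Fintype.card_subtype_compl,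
      Fintype.card_subtype_eq]
    have : 0 < Fintype.card V := Fintype.card_pos_iff.2 ⟨r⟩
    omega
  omega

theorem ReachesRoot.eq_of_parentGraph_eq {f g : {v // v ≠ r} → V} (hf : ReachesRoot f)
    (h : parentGraph f = parentGraph g) : f = g := by
  have key : ∀ {f g : {v // v ≠ r} → V}, ReachesRoot f → parentGraph f = parentGraph g →
      ∀ v, f v ≠ g v → ∃ hr : f v ≠ r, g ⟨f v, hr⟩ = v := by
    intro f g hf h v hne
    have hadj := hf.parentGraph_adj v
    rw [h, parentGraph, SimpleGraph.fromRel_adj] at hadj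
    obtain ⟨-, ⟨_, h'⟩ | h'⟩ := hadj
    · exact absurd h'.symm hne
    · exact h'
  by_contra hne
  obtain ⟨v, hv⟩ := Function.ne_iff.1 hne
  refine hf.not_of_invariant (P := fun u => ∃ hu : u ≠ r, f ⟨u, hu⟩ ≠ g ⟨u, hu⟩) ?_
    (fun ⟨h, _⟩ => h rfl) v ⟨v.2, hv⟩
  rintro u ⟨hu, hfg⟩
  rw [fixRoot_coe f ⟨u, hu⟩]
  obtain ⟨hr, hgu⟩ := key hf h ⟨u, hu⟩ hfg
  exact ⟨hr, fun h' => hf.parent_parent_ne ⟨u, hu⟩ hr (h'.trans hgu)⟩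

theorem SimpleGraph.IsTree.exists_parentGraph_eq {H : SimpleGraph V} (hH : H.IsTree) (r : V) :
    ∃ f : {v // v ≠ r} → V, (∀ v : {v // v ≠ r}, H.Adj v (f v)) ∧
      ReachesRoot f ∧ parentGraph f = H := by
  have hpar : ∀ v : {v // v ≠ r}, ∃ w, H.Adj v w ∧ H.dist w r < H.dist v r := by
    rintro ⟨v, hv⟩
    obtain ⟨p, hp⟩ := hH.connected.exists_walk_length_eq_dist v r
    cases p with
    | nil => exact absurd rfl hv
    | cons h q =>
      refine ⟨_, h, ?_⟩
      have := SimpleGraph.dist_le q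
      rw [SimpleGraph.Walk.length_cons] at hp
      simp only
      omega
  choose f hadj hdist using hpar
  have hf : ReachesRoot f := by
    intro v
    induction hd : H.dist v r using Nat.strong_induction_on generalizing v with | _ d ih => ?_
    by_cases hv : v = r
    · exact ⟨0, hv⟩
    · obtain ⟨k, hk⟩ := ih _ (hd ▸ hdist ⟨v, hv⟩) _ rfl
      exact ⟨k + 1, by rw [Function.iterate_succ_apply, fixRoot_coe f ⟨v, hv⟩, hk]⟩
  have hle : parentGraph f ≤ H := by
    intro a b hab
    rw [parentGraph, SimpleGraph.fromRel_adj] at hab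
    obtain ⟨-, ⟨h, rfl⟩ | ⟨h, rfl⟩⟩ := hab
    · exact hadj ⟨a, h⟩
    · exact (hadj ⟨b, h⟩).symm
  exact ⟨f, hadj, hf, le_antisymm hle
    ((SimpleGraph.isTree_iff_minimal_connected.1 hH).2 hf.connected_parentGraph hle)⟩

theorem numSpanningTrees_eq_ncard_reachesRoot [Finite V] (G : SimpleGraph V) (r : V) :
    numSpanningTrees G =
      {f : {v // v ≠ r} → V | (∀ v : {v // v ≠ r}, G.Adj v (f v)) ∧ ReachesRoot f}.ncard := by
  symm
  refine Set.ncard_congr (fun f _ => parentGraph f) ?_ ?_ ?_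
  · rintro f ⟨hadj, hf⟩
    refine ⟨?_, hf.isTree_parentGraph⟩
    intro a b hab
    rw [parentGraph, SimpleGraph.fromRel_adj] at hab
    obtain ⟨-, ⟨h, rfl⟩ | ⟨h, rfl⟩⟩ := hab
    · exact hadj ⟨a, h⟩
    · exact (hadj ⟨b, h⟩).symm
  · rintro f g ⟨-, hf⟩ - h
    exact hf.eq_of_parentGraph_eq h
  · rintro H ⟨hle, hH⟩
    obtain ⟨f, hadj, hf, rfl⟩ := hH.exists_parentGraph_eq r
    exact ⟨f, ⟨fun v => hle (hadj v), hf⟩, rfl⟩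

variable [Fintype V] [DecidableEq V] {R : Type*} [CommRing R]

/-- The transition matrix of a parent map, with the root removed. -/
def parentMatrix (R : Type*) [Zero R] [One R] (f : {v // v ≠ r} → V) :
    Matrix {v // v ≠ r} {v // v ≠ r} R :=
  Matrix.of fun v w => if f v = w then 1 else 0

theorem parentMatrix_mulVec (f : {v // v ≠ r} → V) (x : V → R) (hx : x r = 0)
    (v : {v // v ≠ r}) :
    (parentMatrix R f).mulVec (fun w => x w) v = x (f v) := by
  simp only [Matrix.mulVec, dotProduct, parentMatrix, Matrix.of_apply, ite_mul, one_mul, zero_mul]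
  by_cases h : f v = r
  · rw [h, hx]
    exact Finset.sum_eq_zero fun w _ => if_neg fun hw => w.2 hw.symm
  · rw [Finset.sum_eq_single ⟨f v, h⟩]
    · simp
    · intro w _ hw
      exact if_neg fun h' => hw (Subtype.ext h'.symm)
    · simp

theorem ReachesRoot.det_one_sub_parentMatrix [IsDomain R] [IsNoetherianRing R]
    {f : {v // v ≠ r} → V} (hf : ReachesRoot f) :
    (1 - parentMatrix R f).det = 1 := by
  classical
  have hiter : ∀ (k : ℕ) (x : V → R), x r = 0 → ∀ v : {v // v ≠ r},
      ((Matrix.toLin' (parentMatrix R f)) ^ k) (fun w => x w) v = x ((fixRoot r f)^[k] v) := by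
    intro k
    induction k with
    | zero => intro x _ v; simp
    | succ k ih =>
      intro x hx v
      rw [pow_succ, Module.End.mul_apply, Matrix.toLin'_apply]
      have : (parentMatrix R f).mulVec (fun w => x w) =
          fun w : {v // v ≠ r} => (fun u => x (fixRoot r f u)) w := by
        funext w
        simp only [parentMatrix_mulVec f x hx, fixRoot_coe]
      rw [this, ih (fun u => x (fixRoot r f u)) (by rw [fixRoot_root, hx]),
        ← Function.iterate_succ_apply' (fixRoot r f)]
  have hnil : (Matrix.toLin' (parentMatrix R f)).charpoly =
      Polynomial.X ^ Module.finrank R ({v // v ≠ r} → R) := by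
    rw [LinearMap.charpoly_eq_X_pow_iff]
    intro m
    choose k hk using hf
    refine ⟨∑ v, k v, funext fun v => ?_⟩
    have h := hiter (∑ v, k v) (fun u => if h : u ≠ r then m ⟨u, h⟩ else 0) (by simp) v
    have hm : (fun w : {v // v ≠ r} =>
        (fun u => if h : u ≠ r then m ⟨u, h⟩ else 0) (w : V)) = m := by
      funext w
      simp [w.2]
    rw [hm] at h
    rw [h]
    have hle : k v ≤ ∑ v, k v :=
      Finset.single_le_sum (fun _ _ => Nat.zero_le _) (Finset.mem_univ v.1)
    obtain ⟨l, hl⟩ := Nat.exists_eq_add_of_le hle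
    rw [hl, add_comm, Function.iterate_add_apply, hk, fixRoot_iterate_root]
    simp
  have h1 := congrArg (Polynomial.eval 1) hnil
  rw [Matrix.charpoly_toLin', Matrix.eval_charpoly] at h1
  simpa using h1

theorem det_one_sub_parentMatrix_of_not_reachesRoot [IsDomain R] {f : {v // v ≠ r} → V}
    (hf : ¬ ReachesRoot f) : (1 - parentMatrix R f).det = 0 := by
  classical
  rw [ReachesRoot] at hf
  push Not at hf
  obtain ⟨v, hv⟩ := hf
  have hvr : v ≠ r := hv 0
  let x : V → R := fun u => if ∀ k : ℕ, (fixRoot r f)^[k] u ≠ r then 1 else 0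
  have hxr : x r = 0 := if_neg fun h => h 0 rfl
  refine Matrix.exists_mulVec_eq_zero_iff.1 ⟨fun w => x w, fun h => ?_, ?_⟩
  · have := congrFun h ⟨v, hvr⟩
    simp only [x, if_pos hv, Pi.zero_apply] at this
    exact one_ne_zero this
  · rw [Matrix.sub_mulVec, Matrix.one_mulVec, sub_eq_zero]
    funext w
    rw [parentMatrix_mulVec f x hxr]
    have : (∀ k : ℕ, (fixRoot r f)^[k] w ≠ r) ↔ ∀ k : ℕ, (fixRoot r f)^[k] (f w) ≠ r := by
      simp only [← fixRoot_coe f w, ← Function.iterate_succ_apply]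
      refine ⟨fun h k => h (k + 1), fun h k => ?_⟩
      cases k with
      | zero => exact w.2
      | succ k => exact h k
    simp only [x, this]

/-- **Matrix-tree theorem**: the number of spanning trees is the determinant of the reduced
Laplacian. -/
theorem det_reduced_lapMatrix_eq_numSpanningTrees [IsDomain R] [IsNoetherianRing R]
    (G : SimpleGraph V) [DecidableRel G.Adj] (r : V) :
    ((G.lapMatrix R).submatrix (Subtype.val : {v // v ≠ r} → V) Subtype.val).det =
      numSpanningTrees G := by
  classical
  have hrows : (G.lapMatrix R).submatrix (Subtype.val : {v // v ≠ r} → V) Subtype.val =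
      fun v : {v // v ≠ r} => ∑ w ∈ G.neighborFinset v, fun u : {v // v ≠ r} =>
        (1 : Matrix {v // v ≠ r} {v // v ≠ r} R) v u - if w = u then 1 else 0 := by
    funext v u
    rw [Finset.sum_apply, Finset.sum_sub_distrib, Finset.sum_const, Finset.sum_ite_eq',
      SimpleGraph.card_neighborFinset_eq_degree]
    simp [SimpleGraph.lapMatrix, SimpleGraph.degMatrix, SimpleGraph.adjMatrix_apply,
      Matrix.diagonal_apply, Matrix.one_apply, Subtype.ext_iff]
  have hexp := MultilinearMap.map_sum_finset
    (Matrix.detRowAlternating (n := {v // v ≠ r}) (R := R)).toMultilinearMap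
    (fun (v : {v // v ≠ r}) (w : V) => fun u : {v // v ≠ r} =>
        (1 : Matrix {v // v ≠ r} {v // v ≠ r} R) v u - if w = u then 1 else 0)
    (fun v => G.neighborFinset v)
  rw [hrows]
  refine hexp.trans ?_
  have hterm : ∀ f : {v // v ≠ r} → V,
      Matrix.det (fun v u : {v // v ≠ r} =>
        (1 : Matrix {v // v ≠ r} {v // v ≠ r} R) v u - if f v = u then 1 else 0) =
      if ReachesRoot f then 1 else 0 := by
    intro f
    split_ifs with hf
    · exact hf.det_one_sub_parentMatrix
    · exact det_one_sub_parentMatrix_of_not_reachesRoot hf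
  refine (Finset.sum_congr rfl fun f _ => hterm f).trans ?_
  rw [Finset.sum_boole, numSpanningTrees_eq_ncard_reachesRoot G r, ← Set.ncard_coe_finset]
  congr 2
  ext f
  simp [Fintype.mem_piFinset]

end MatrixTree

section EvenOdd

variable {m : ℕ}

theorem natCast_ne_zero_of_lt {n a : ℕ} (h0 : 0 < a) (h : a < n) : (a : ZMod n) ≠ 0 := by
  rw [Ne, ZMod.natCast_eq_zero_iff]
  exact Nat.not_dvd_of_pos_of_lt h0 h

/-- The residues `1, …, m` modulo `2m + 1`. -/
def posResidue (i : Fin m) : ZMod (2 * m + 1) := ((i + 1 : ℕ) : ZMod (2 * m + 1))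

theorem posResidue_ne_zero (i : Fin m) : posResidue i ≠ 0 :=
  natCast_ne_zero_of_lt (by omega) (by omega)

theorem posResidue_injective : Function.Injective (posResidue (m := m)) := by
  intro i j h
  rw [posResidue, posResidue, ZMod.natCast_eq_natCast_iff', Nat.mod_eq_of_lt (by omega),
    Nat.mod_eq_of_lt (by omega)] at h
  exact Fin.ext (by omega)

theorem posResidue_ne_neg (i j : Fin m) : posResidue i ≠ -posResidue j := by
  rw [Ne, ← add_eq_zero_iff_eq_neg, posResidue, posResidue, ← Nat.cast_add]
  exact natCast_ne_zero_of_lt (by omega) (by omega)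

/-- The nonzero residues modulo `2m + 1` are `±1, …, ±m`. -/
noncomputable def signedResidueEquiv (m : ℕ) :
    Fin m ⊕ Fin m ≃ {v : ZMod (2 * m + 1) // v ≠ 0} :=
  Equiv.ofBijective
    (Sum.elim (fun i => ⟨posResidue i, posResidue_ne_zero i⟩)
      (fun i => ⟨-posResidue i, neg_ne_zero.2 (posResidue_ne_zero i)⟩)) <| by
    rw [Fintype.bijective_iff_injective_and_card]
    constructor
    · rintro (i | i) (j | j) h <;> simp only [Sum.elim_inl, Sum.elim_inr, Subtype.mk.injEq] at h
      · rw [posResidue_injective h]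
      · exact absurd h (posResidue_ne_neg i j)
      · exact absurd h.symm (posResidue_ne_neg j i)
      · rw [posResidue_injective (neg_injective h)]
    · rw [Fintype.card_subtype_compl, Fintype.card_subtype_eq, ZMod.card]
      simp
      omega

theorem signedResidueEquiv_inl (i : Fin m) :
    (signedResidueEquiv m (Sum.inl i) : ZMod (2 * m + 1)) = posResidue i := rfl

theorem signedResidueEquiv_inr (i : Fin m) :
    (signedResidueEquiv m (Sum.inr i) : ZMod (2 * m + 1)) = -posResidue i := rfl

theorem zmod_cases (v : ZMod (2 * m + 1)) :
    v = 0 ∨ (∃ i : Fin m, v = posResidue i) ∨ ∃ i : Fin m, v = -posResidue i := by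
  by_cases hv : v = 0
  · exact Or.inl hv
  · right
    obtain ⟨i | i, hi⟩ := (signedResidueEquiv m).surjective ⟨v, hv⟩
    · exact Or.inl ⟨i, (congrArg Subtype.val hi).symm⟩
    · exact Or.inr ⟨i, (congrArg Subtype.val hi).symm⟩

theorem sum_zmod_eq {R : Type*} [AddCommMonoid R] (g : ZMod (2 * m + 1) → R) :
    ∑ v, g v = g 0 + (∑ i : Fin m, g (posResidue i) + ∑ i : Fin m, g (-posResidue i)) := by
  rw [Fintype.sum_eq_add_sum_subtype_ne g 0, ← (signedResidueEquiv m).sum_comp (fun v => g v),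
    Fintype.sum_sum_type]
  rfl

section CommRing

variable {R : Type*} [CommRing R] (l : ZMod (2 * m + 1) → R)

/-- Convolution by `l` acting on even functions that vanish at `0`, with the value at `0`
discarded. -/
def evenBlock : Matrix (Fin m) (Fin m) R :=
  Matrix.of fun i j => l (posResidue i - posResidue j) + l (posResidue i + posResidue j)

/-- Convolution by `l` acting on odd functions. -/
def oddBlock : Matrix (Fin m) (Fin m) R :=
  Matrix.of fun i j => l (posResidue i - posResidue j) - l (posResidue i + posResidue j)

theorem det_fromBlocks_comm {ι : Type*} [Fintype ι] [DecidableEq ι] (B C : Matrix ι ι R) :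
    (Matrix.fromBlocks B C C B).det = (B + C).det * (B - C).det := by
  have h : Matrix.fromBlocks 1 0 (-1) 1 * Matrix.fromBlocks B C C B *
      Matrix.fromBlocks 1 0 1 1 = Matrix.fromBlocks (B + C) C 0 (B - C) := by
    rw [Matrix.fromBlocks_multiply, Matrix.fromBlocks_multiply]
    congr 1 <;> (simp; try abel)
  have hdet := congrArg Matrix.det h
  rw [Matrix.det_mul, Matrix.det_mul, Matrix.det_fromBlocks_zero₁₂, Matrix.det_fromBlocks_zero₁₂,
    Matrix.det_fromBlocks_zero₂₁] at hdet
  simpa using hdet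

theorem det_circulant_eq_evenBlock_mul_oddBlock (hl : ∀ x, l (-x) = l x) :
    (Matrix.of fun u v : {v : ZMod (2 * m + 1) // v ≠ 0} => l (u - v)).det =
      (evenBlock l).det * (oddBlock l).det := by
  rw [← Matrix.det_submatrix_equiv_self (signedResidueEquiv m)]
  refine Eq.trans ?_ (det_fromBlocks_comm
    (Matrix.of fun i j : Fin m => l (posResidue i - posResidue j))
    (Matrix.of fun i j : Fin m => l (posResidue i + posResidue j)))
  congr 1
  ext (i | i) (j | j)
  · rfl
  · simp [signedResidueEquiv_inl, signedResidueEquiv_inr]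
  · simp only [Matrix.submatrix_apply, Matrix.of_apply, signedResidueEquiv_inl,
      signedResidueEquiv_inr, Matrix.fromBlocks_apply₂₁]
    rw [← hl]
    congr 1
    ring
  · simp only [Matrix.submatrix_apply, Matrix.of_apply, signedResidueEquiv_inr,
      Matrix.fromBlocks_apply₂₂]
    rw [← hl]
    congr 1
    ring

/-- The even function with prescribed values at `1, …, m` that vanishes at `0`. -/
noncomputable def evenExt : (Fin m → R) →ₗ[R] (ZMod (2 * m + 1) → R) where
  toFun u v := if h : v ≠ 0 then u (((signedResidueEquiv m).symm ⟨v, h⟩).elim id id) else 0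
  map_add' u w := by
    funext v
    by_cases h : v = 0 <;> simp [h]
  map_smul' c u := by
    funext v
    by_cases h : v = 0 <;> simp [h]

theorem evenExt_zero (u : Fin m → R) : evenExt u 0 = 0 := by
  simp [evenExt]

theorem evenExt_posResidue (u : Fin m → R) (i : Fin m) : evenExt u (posResidue i) = u i := by
  have h : (signedResidueEquiv m).symm ⟨posResidue i, posResidue_ne_zero i⟩ = Sum.inl i :=
    (Equiv.symm_apply_eq _).2 rfl
  simp [evenExt, posResidue_ne_zero, h]

theorem evenExt_neg_posResidue (u : Fin m → R) (i : Fin m) :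
    evenExt u (-posResidue i) = u i := by
  have h : (signedResidueEquiv m).symm
      ⟨-posResidue i, neg_ne_zero.2 (posResidue_ne_zero i)⟩ = Sum.inr i :=
    (Equiv.symm_apply_eq _).2 rfl
  simp [evenExt, posResidue_ne_zero, h]

theorem eq_evenExt {F : ZMod (2 * m + 1) → R} (h0 : F 0 = 0) (hF : ∀ v, F (-v) = F v) :
    evenExt (fun i => F (posResidue i)) = F := by
  funext v
  obtain rfl | ⟨i, rfl⟩ | ⟨i, rfl⟩ := zmod_cases v
  · rw [evenExt_zero, h0]
  · rw [evenExt_posResidue]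
  · rw [evenExt_neg_posResidue, hF]

theorem evenExt_neg (u : Fin m → R) (v : ZMod (2 * m + 1)) : evenExt u (-v) = evenExt u v := by
  obtain rfl | ⟨i, rfl⟩ | ⟨i, rfl⟩ := zmod_cases v
  · rw [neg_zero]
  · rw [evenExt_posResidue, evenExt_neg_posResidue]
  · rw [neg_neg, evenExt_posResidue, evenExt_neg_posResidue]

/-- Convolution on `ℤ/(2m+1)ℤ`. -/
def cyclicConv (F : ZMod (2 * m + 1) → R) (v : ZMod (2 * m + 1)) : R :=
  ∑ w, l w * F (v - w)

theorem cyclicConv_eq (F : ZMod (2 * m + 1) → R) (v : ZMod (2 * m + 1)) :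
    cyclicConv l F v = ∑ w, l (v - w) * F w := by
  rw [cyclicConv, ← (Equiv.subLeft v).sum_comp]
  simp

theorem sum_cyclicConv (hl : ∑ v, l v = 0) (F : ZMod (2 * m + 1) → R) :
    ∑ v, cyclicConv l F v = 0 := by
  simp only [cyclicConv]
  rw [Finset.sum_comm]
  have : ∀ w, ∑ v, l w * F (v - w) = l w * ∑ v, F v := by
    intro w
    rw [← Finset.mul_sum, ← (Equiv.subRight w).sum_comp F]
    rfl
  rw [Finset.sum_congr rfl fun w _ => this w, ← Finset.sum_mul, hl, zero_mul]

theorem cyclicConv_neg (hl : ∀ x, l (-x) = l x) {F : ZMod (2 * m + 1) → R}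
    (hF : ∀ v, F (-v) = F v) (v : ZMod (2 * m + 1)) :
    cyclicConv l F (-v) = cyclicConv l F v := by
  rw [cyclicConv, cyclicConv, ← Equiv.sum_comp (Equiv.neg _)]
  refine Finset.sum_congr rfl fun w _ => ?_
  rw [Equiv.neg_apply, hl, ← hF]
  congr 2
  ring

theorem evenBlock_mulVec (u : Fin m → R) (i : Fin m) :
    (evenBlock l).mulVec u i = cyclicConv l (evenExt u) (posResidue i) := by
  rw [cyclicConv_eq, sum_zmod_eq, evenExt_zero, mul_zero, zero_add, ← Finset.sum_add_distrib,
    Matrix.mulVec, dotProduct]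
  refine Finset.sum_congr rfl fun j _ => ?_
  rw [evenExt_posResidue, evenExt_neg_posResidue, evenBlock, Matrix.of_apply, sub_neg_eq_add,
    add_mul]

theorem oddBlock_mulVec {F : ZMod (2 * m + 1) → R} (h0 : F 0 = 0) (hF : ∀ v, F (-v) = -F v)
    (i : Fin m) :
    (oddBlock l).mulVec (fun j => F (posResidue j)) i = cyclicConv l F (posResidue i) := by
  rw [cyclicConv_eq, sum_zmod_eq, h0, mul_zero, zero_add, ← Finset.sum_add_distrib,
    Matrix.mulVec, dotProduct]
  refine Finset.sum_congr rfl fun j _ => ?_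
  rw [hF, oddBlock, Matrix.of_apply, sub_neg_eq_add]
  ring

/-- The central difference with half-step `m + 1`, the inverse of `2` modulo `2m + 1`. -/
def centralDiff (F : ZMod (2 * m + 1) → R) (v : ZMod (2 * m + 1)) : R :=
  F (v + (m + 1)) - F (v - (m + 1))

theorem cyclicConv_centralDiff (F : ZMod (2 * m + 1) → R) (v : ZMod (2 * m + 1)) :
    cyclicConv l (centralDiff F) v = centralDiff (cyclicConv l F) v := by
  simp only [cyclicConv, centralDiff, ← Finset.sum_sub_distrib, ← mul_sub]
  refine Finset.sum_congr rfl fun w _ => ?_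
  rw [add_sub_right_comm, sub_right_comm]

theorem centralDiff_neg {F : ZMod (2 * m + 1) → R} (hF : ∀ v, F (-v) = F v)
    (v : ZMod (2 * m + 1)) : centralDiff F (-v) = -centralDiff F v := by
  rw [centralDiff, centralDiff, neg_sub, ← hF (v + _), ← hF (v - _)]
  congr 2 <;> ring

theorem centralDiff_zero {F : ZMod (2 * m + 1) → R} (hF : ∀ v, F (-v) = F v) :
    centralDiff F 0 = 0 := by
  rw [centralDiff, zero_add, zero_sub, hF, sub_self]

/-- A function with vanishing central difference is constant. -/
theorem eq_const_of_centralDiff_eq_zero {F : ZMod (2 * m + 1) → R}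
    (hF : ∀ v, centralDiff F v = 0) (v : ZMod (2 * m + 1)) : F v = F 0 := by
  have hstep : ∀ v, F (v + 1) = F v := by
    intro v
    have h := hF (v + (m + 1))
    rw [centralDiff, add_sub_cancel_right, sub_eq_zero] at h
    rw [← h]
    congr 1
    have h0 : ((2 * m + 1 : ℕ) : ZMod (2 * m + 1)) = 0 := ZMod.natCast_self _
    push_cast at h0
    linear_combination -h0
  have hnat : ∀ k : ℕ, F (k : ZMod (2 * m + 1)) = F 0 := by
    intro k
    induction k with
    | zero => rw [Nat.cast_zero]
    | succ k ih => rw [Nat.cast_succ, hstep, ih]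
  rw [← ZMod.natCast_zmod_val v, hnat]

/-- The central difference from even functions vanishing at `0` to odd functions, in
coordinates. -/
noncomputable def evenToOdd : (Fin m → R) →ₗ[R] (Fin m → R) where
  toFun u i := centralDiff (evenExt u) (posResidue i)
  map_add' u w := by
    funext i
    simp only [centralDiff, map_add, Pi.add_apply]
    ring
  map_smul' c u := by
    funext i
    simp only [centralDiff, map_smul, Pi.smul_apply, smul_eq_mul, RingHom.id_apply]
    ring

theorem evenToOdd_injective : Function.Injective (evenToOdd (m := m) (R := R)) := by
  rw [← LinearMap.ker_eq_bot, LinearMap.ker_eq_bot']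
  intro u hu
  have hpos : ∀ i, centralDiff (evenExt u) (posResidue i) = 0 := fun i => congrFun hu i
  have hD : ∀ v, centralDiff (evenExt u) v = 0 := by
    intro v
    obtain rfl | ⟨i, rfl⟩ | ⟨i, rfl⟩ := zmod_cases v
    · exact centralDiff_zero (evenExt_neg u)
    · exact hpos i
    · rw [centralDiff_neg (evenExt_neg u), hpos, neg_zero]
  funext i
  rw [← evenExt_posResidue u i, eq_const_of_centralDiff_eq_zero hD, evenExt_zero, Pi.zero_apply]

theorem evenToOdd_intertwines (hl : ∀ x, l (-x) = l x) (hsum : ∑ v, l v = 0) (u : Fin m → R) :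
    evenToOdd (((1 + Matrix.of fun _ _ => 2) * evenBlock l).mulVec u) =
      (oddBlock l).mulVec (evenToOdd u) := by
  have heven : ∀ v, cyclicConv l (evenExt u) (-v) = cyclicConv l (evenExt u) v :=
    cyclicConv_neg l hl (evenExt_neg u)
  have htotal := sum_cyclicConv l hsum (evenExt u)
  rw [sum_zmod_eq] at htotal
  simp only [heven] at htotal
  have hcoord : ((1 + Matrix.of fun _ _ => 2) * evenBlock l).mulVec u =
      fun i => cyclicConv l (evenExt u) (posResidue i) - cyclicConv l (evenExt u) 0 := by
    funext i
    rw [← Matrix.mulVec_mulVec, Matrix.add_mulVec, Matrix.one_mulVec, Pi.add_apply,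
      evenBlock_mulVec]
    simp only [Matrix.mulVec, dotProduct, Matrix.of_apply]
    rw [← Finset.mul_sum]
    have h := fun j => evenBlock_mulVec l u j
    simp only [Matrix.mulVec, dotProduct] at h
    simp only [h]
    linear_combination htotal
  funext i
  change centralDiff (evenExt _) _ = _
  rw [hcoord, eq_evenExt (F := fun v => cyclicConv l (evenExt u) v - cyclicConv l (evenExt u) 0)
    (sub_self _) (fun v => by rw [heven])]
  refine Eq.trans ?_ (oddBlock_mulVec l (centralDiff_zero (evenExt_neg u))
    (centralDiff_neg (evenExt_neg u)) i).symm
  rw [cyclicConv_centralDiff, centralDiff, centralDiff, sub_sub_sub_cancel_right]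

end CommRing

theorem det_oddBlock_of_field {K : Type*} [Field K] (l : ZMod (2 * m + 1) → K)
    (hl : ∀ x, l (-x) = l x) (hsum : ∑ v, l v = 0) :
    (oddBlock l).det = (2 * m + 1) * (evenBlock l).det := by
  let e := LinearEquiv.ofInjectiveEndo (evenToOdd (m := m) (R := K)) evenToOdd_injective
  have hconj : (Matrix.toLin' (oddBlock l)) =
      e ∘ₗ Matrix.toLin' ((1 + Matrix.of fun _ _ => 2) * evenBlock l) ∘ₗ e.symm := by
    refine LinearMap.ext fun w => ?_
    obtain ⟨u, rfl⟩ := e.surjective w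
    simp only [LinearMap.comp_apply, LinearEquiv.coe_coe, LinearEquiv.symm_apply_apply,
      Matrix.toLin'_apply]
    exact (evenToOdd_intertwines l hl hsum u).symm
  have hdet := congrArg LinearMap.det hconj
  rw [LinearMap.det_conj, LinearMap.det_toLin', LinearMap.det_toLin', Matrix.det_mul] at hdet
  rw [hdet]
  congr 1
  have hones : (Matrix.of fun _ _ => 2 : Matrix (Fin m) (Fin m) K) =
      Matrix.replicateCol Unit (fun _ => (2 : K)) *
        Matrix.replicateRow Unit (fun _ => (1 : K)) := by
    ext i j
    simp [Matrix.mul_apply]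
  rw [hones, Matrix.det_one_add_replicateCol_mul_replicateRow]
  simp [dotProduct]
  ring

theorem det_oddBlock (l : ZMod (2 * m + 1) → ℤ) (hl : ∀ x, l (-x) = l x)
    (hsum : ∑ v, l v = 0) : (oddBlock l).det = (2 * m + 1) * (evenBlock l).det := by
  have h := det_oddBlock_of_field (fun v => (l v : ℚ)) (fun x => by rw [hl])
    (by exact_mod_cast hsum)
  have hodd : oddBlock (fun v => (l v : ℚ)) = (oddBlock l).map (Int.cast : ℤ → ℚ) := by
    ext i j
    simp [oddBlock]
  have heven : evenBlock (fun v => (l v : ℚ)) = (evenBlock l).map (Int.cast : ℤ → ℚ) := by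
    ext i j
    simp [evenBlock]
  rw [hodd, heven, ← Int.cast_det, ← Int.cast_det] at h
  exact_mod_cast h

end EvenOdd

section Circulant

variable {G : Type*} [AddGroup G] [Fintype G] [DecidableEq G]

theorem lapMatrix_circulantGraph_translate (s : Set G)
    [DecidableRel (SimpleGraph.circulantGraph s).Adj] (u v d : G) :
    (SimpleGraph.circulantGraph s).lapMatrix ℤ (u + d) (v + d) =
      (SimpleGraph.circulantGraph s).lapMatrix ℤ u v := by
  have hdeg : ((SimpleGraph.circulantGraph s).degree (u + d) : ℤ) =
      (SimpleGraph.circulantGraph s).degree u := by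
    rw [SimpleGraph.degree_eq_sum_if_adj, SimpleGraph.degree_eq_sum_if_adj,
      ← Equiv.sum_comp (Equiv.addRight d)]
    simp only [Equiv.coe_addRight, SimpleGraph.circulantGraph_adj_translate]
  simp only [SimpleGraph.lapMatrix, SimpleGraph.degMatrix, Matrix.sub_apply,
    Matrix.diagonal_apply, SimpleGraph.adjMatrix_apply, add_left_inj, hdeg,
    SimpleGraph.circulantGraph_adj_translate]

end Circulant

/-- The number of spanning trees of a circulant graph of odd order `n` is `n` times a square. -/
theorem numSpanningTrees_circulantGraph_eq_mul_sq {n : ℕ} (hn : Odd n) (s : Set (ZMod n)) :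
    ∃ a : ℕ, numSpanningTrees (SimpleGraph.circulantGraph s) = n * a ^ 2 := by
  obtain ⟨m, rfl⟩ := hn
  set L := (SimpleGraph.circulantGraph s).lapMatrix ℤ with hL
  let l : ZMod (2 * m + 1) → ℤ := fun x => L x 0
  have hLl : ∀ u v, L u v = l (u - v) := by
    intro u v
    have := lapMatrix_circulantGraph_translate s (u - v) 0 v
    rwa [sub_add_cancel, zero_add] at this
  have hsymm : ∀ u v, L u v = L v u := fun u v =>
    ((SimpleGraph.circulantGraph s).isSymm_lapMatrix (R := ℤ)).apply v u
  have heven : ∀ x, l (-x) = l x := by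
    intro x
    rw [← zero_sub, ← hLl, hsymm]
  have hsum : ∑ v, l v = 0 := by
    have h := congrFun ((SimpleGraph.circulantGraph s).lapMatrix_mulVec_const_eq_zero (R := ℤ)) 0
    simp only [Matrix.mulVec, dotProduct, mul_one, Pi.zero_apply] at h
    rw [← h]
    exact Finset.sum_congr rfl fun v _ => hsymm v 0
  have htree := det_reduced_lapMatrix_eq_numSpanningTrees (R := ℤ)
    (SimpleGraph.circulantGraph s) 0
  have hsub : ((SimpleGraph.circulantGraph s).lapMatrix ℤ).submatrix
      (Subtype.val : {v : ZMod (2 * m + 1) // v ≠ 0} → _) Subtype.val =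
      Matrix.of fun u v : {v : ZMod (2 * m + 1) // v ≠ 0} => l (u - v) := by
    ext u v
    exact hLl u v
  rw [hsub, det_circulant_eq_evenBlock_mul_oddBlock l heven, det_oddBlock l heven hsum] at htree
  refine ⟨(evenBlock l).det.natAbs, ?_⟩
  zify
  rw [← htree, sq_abs]
  ring

/-- for odd `n ≥ 3`, the number of spanning trees of `C_n(s_1,…,s_k)`
equals `n · a²` for some nonnegative integer `a`. -/
theorem statement10 (n k : ℕ) (hodd : Odd n) (hn : 3 ≤ n) (hk : 0 < k) (s : Fin k → ℕ)
    (hmono : StrictMono s) (h1 : ∀ j, 1 ≤ s j) (h2 : ∀ j, 2 * s j < n)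
    (hgcd : Nat.gcd (Finset.univ.gcd s) n = 1) :
    ∃ a : ℕ, numSpanningTrees (circulant n s) = n * a ^ 2 :=
  numSpanningTrees_circulantGraph_eq_mul_sq hodd _
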